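/- For every positive integer n, in ℤ[q] one has ∑_{τ} q^{exc(τ)} (−1)^{cyc(τ)} = −q · [n−1]_q, where the sum is over all derangements τ ∈ S_n (permutations with τ(i) ≠ i for all i). -/

import Mathlib

open Finset Polynomial

/-- Number of excedances of a permutation: #{i : τ(i) > i}. -/
def exc {n : ℕ} (τ : Equiv.Perm (Fin n)) : ℕ :=
  (Finset.univ.filter fun i => i < τ i).card

/-- Number of cycles of a permutation, counting fixed points as cycles. -/
def cyc {n : ℕ} (τ : Equiv.Perm (Fin n)) : ℕ :=
  Multiset.card τ.cycleType + (Finset.univ.filter fun i => τ i = i).card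

/-- Color sum of a colored permutation. -/
def csum {r n : ℕ} (z : Fin n → Fin r) : ℕ := ∑ i, (z i : ℕ)

/-- #{i : z_i = 0 and τ(i) > i}. -/
def excA {r n : ℕ} (z : Fin n → Fin r) (τ : Equiv.Perm (Fin n)) : ℕ :=
  (Finset.univ.filter fun i => (z i : ℕ) = 0 ∧ i < τ i).card

/-- Excedance number with respect to the absolute order. -/
def excAbs {r n : ℕ} (z : Fin n → Fin r) (τ : Equiv.Perm (Fin n)) : ℕ :=
  exc τ + csum z

/-- Excedance number with respect to the color order. -/
def excClr {r n : ℕ} (z : Fin n → Fin r) (τ : Equiv.Perm (Fin n)) : ℕ :=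
  r * excA z τ + csum z

/-- The sign of a permutation of `n` points with `c` cycles is `(-1) ^ (n + c)`. -/
theorem neg_one_pow_cyc {n : ℕ} (τ : Equiv.Perm (Fin n)) :
    (-1 : Polynomial ℤ) ^ cyc τ = (-1) ^ n * ((Equiv.Perm.sign τ : ℤ) : Polynomial ℤ) := by
  have hn : τ.support.card + (Finset.univ.filter fun i => τ i = i).card = n := by
    rw [add_comm]
    simpa [Equiv.Perm.support] using
      Finset.card_filter_add_card_filter_not (s := Finset.univ) (fun i => τ i = i)
  have h : (-1 : Polynomial ℤ) ^ n =
      (-1) ^ τ.support.card * (-1) ^ (Finset.univ.filter fun i => τ i = i).card := by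
    rw [← pow_add, hn]
  have hs : (-1 : Polynomial ℤ) ^ τ.support.card * (-1) ^ τ.support.card = 1 := by
    rw [← mul_pow]
    simp
  rw [Equiv.Perm.sign_of_cycleType, Equiv.Perm.sum_cycleType, cyc, h]
  push_cast
  rw [pow_add, pow_add]
  linear_combination -(-1) ^ Multiset.card τ.cycleType *
    (-1) ^ (Finset.univ.filter fun i => τ i = i).card * hs

/-- The matrix with `X` below, `0` on and `1` above the diagonal. -/
noncomputable def excMatrix (n : ℕ) : Matrix (Fin n) (Fin n) (Polynomial ℤ) :=
  Matrix.of fun a b => if b < a then X else if a = b then 0 else 1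

theorem prod_excMatrix {n : ℕ} (τ : Equiv.Perm (Fin n)) :
    ∏ i, excMatrix n (τ i) i = if ∀ i, τ i ≠ i then (X : Polynomial ℤ) ^ exc τ else 0 := by
  split_ifs with h
  · rw [exc, ← Finset.prod_const, Finset.prod_filter]
    exact Finset.prod_congr rfl fun i _ => by simp [excMatrix, h i]
  · push Not at h
    obtain ⟨i, hi⟩ := h
    exact Finset.prod_eq_zero (Finset.mem_univ i) (by simp [excMatrix, hi])

theorem sum_derangements_eq_det (n : ℕ) :
    ∑ τ ∈ Finset.univ.filter (fun τ : Equiv.Perm (Fin n) => ∀ i, τ i ≠ i),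
      (X : Polynomial ℤ) ^ exc τ * (-1) ^ cyc τ = (-1) ^ n * (excMatrix n).det := by
  rw [Matrix.det_apply', Finset.mul_sum, Finset.sum_filter]
  refine Finset.sum_congr rfl fun τ _ => ?_
  rw [prod_excMatrix, neg_one_pow_cyc]
  split_ifs <;> ring

/-- Adding a constant `t` to all entries changes the determinant by an affine function of `t`. -/
theorem exists_det_add_const {m R : Type*} [Fintype m] [DecidableEq m] [CommRing R]
    (A : Matrix m m R) (hA : IsUnit A.det) :
    ∃ v : R, ∀ t : R, (A + Matrix.of fun _ _ => t).det = A.det * (1 + t * v) := by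
  let u : m → R := fun _ => 1
  let B : Matrix Unit Unit R := Matrix.replicateRow Unit u * A⁻¹ * Matrix.replicateCol Unit u
  refine ⟨B () (), fun t => ?_⟩
  have h : (Matrix.of fun _ _ => t : Matrix m m R) =
      Matrix.replicateCol Unit (t • u) * Matrix.replicateRow Unit u := by
    ext
    simp [Matrix.mul_apply, u]
  rw [h, Matrix.det_add_replicateCol_mul_replicateRow hA, Matrix.replicateCol_smul,
    Matrix.mul_smul]
  simp [Matrix.det_unique, B]

theorem det_excMatrix_sub_one (n : ℕ) :
    (excMatrix n - Matrix.of fun _ _ => 1).det = (-1) ^ n := by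
  rw [Matrix.det_of_isLowerTriangular]
  · simp [excMatrix]
  · intro i j hij
    have hij : i < j := hij
    simp [excMatrix, hij.not_gt, hij.ne]

theorem det_excMatrix_sub_X (n : ℕ) :
    (excMatrix n - Matrix.of fun _ _ => X).det = (-X) ^ n := by
  rw [Matrix.det_of_isUpperTriangular]
  · simp [excMatrix]
  · intro i j hij
    have hij : j < i := hij
    simp [excMatrix, hij]

theorem X_sub_one_mul_det_excMatrix (n : ℕ) :
    (X - 1) * (excMatrix n).det = (-1) ^ n * (X - X ^ n) := by
  have hL := det_excMatrix_sub_one n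
  obtain ⟨v, hv⟩ := exists_det_add_const (excMatrix n - Matrix.of fun _ _ => 1)
    (by rw [hL]; exact isUnit_one.neg.pow n)
  have h₁ := hv 1
  have h₂ := hv (1 - X)
  rw [sub_add_cancel, hL] at h₁
  rw [show (excMatrix n - Matrix.of fun _ _ => 1) + (Matrix.of fun _ _ => 1 - X) =
    excMatrix n - Matrix.of fun _ _ => X by ext1; simp, hL, det_excMatrix_sub_X, neg_pow] at h₂
  linear_combination (X - 1) * h₁ + h₂

theorem stmt13 (n : ℕ) (hn : 0 < n) :
    ∑ τ ∈ Finset.univ.filter (fun τ : Equiv.Perm (Fin n) => ∀ i, τ i ≠ i),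
      (X : Polynomial ℤ) ^ exc τ * (-1) ^ cyc τ =
    -(X : Polynomial ℤ) * ∑ i ∈ Finset.range (n - 1), (X : Polynomial ℤ) ^ i := by
  obtain ⟨n, rfl⟩ := Nat.exists_eq_add_one.mpr hn
  rw [sum_derangements_eq_det, Nat.add_sub_cancel]
  refine mul_left_cancel₀ (Polynomial.X_sub_C_ne_zero (1 : ℤ)) ?_
  have h := X_sub_one_mul_det_excMatrix (n + 1)
  have hs : ((-1 : Polynomial ℤ) ^ (n + 1)) * (-1) ^ (n + 1) = 1 := by
    rw [← mul_pow]
    simp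
  have hg := geom_sum_mul (X : Polynomial ℤ) n
  rw [map_one]
  linear_combination (-1) ^ (n + 1) * h + X * hg + (X - X ^ (n + 1)) * hs
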